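/- Every formula φ ∈ L_{□,◇,∧,∨}[Prop] is logically equivalent to a normal form of level d(φ), where d(φ) is the modal depth of φ. -/

import Mathlib

/-- Modal formulas over propositional variables `α`, in negation normal form. -/
inductive MF (α : Type) : Type
  | top : MF α
  | bot : MF α
  | var : α → MF α
  | nvar : α → MF α
  | and : MF α → MF α → MF α
  | or : MF α → MF α → MF α
  | dia : MF α → MF α
  | box : MF α → MF α

/-- A pointed Kripke model over propositional variables `α`. -/
structure PModel (α : Type) where
  World : Type
  Rel : World → World → Prop
  val : World → Set α
  pt : World

/-- Satisfaction of a modal formula at a world of a Kripke model. -/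
def Sat {α : Type} (M : PModel α) : M.World → MF α → Prop
  | _, MF.top => True
  | _, MF.bot => False
  | w, MF.var p => p ∈ M.val w
  | w, MF.nvar p => p ∉ M.val w
  | w, MF.and φ ψ => Sat M w φ ∧ Sat M w ψ
  | w, MF.or φ ψ => Sat M w φ ∨ Sat M w ψ
  | w, MF.dia φ => ∃ u, M.Rel w u ∧ Sat M u φ
  | w, MF.box φ => ∀ u, M.Rel w u → Sat M u φ

/-- Satisfaction at the distinguished point of a pointed model. -/
def PSat {α : Type} (M : PModel α) (φ : MF α) : Prop := Sat M M.pt φ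

/-- Logical equivalence: satisfied by exactly the same pointed models. -/
def MFEquiv {α : Type} (φ ψ : MF α) : Prop := ∀ M : PModel α, PSat M φ ↔ PSat M ψ
/-- The fragment L_{□,◇,∧,∨}: formulas built from propositional variables using
only the connectives ∧, ∨, ◇, □ (no ⊤, ⊥, negation). -/
inductive PosForm {α : Type} : MF α → Prop
  | var (p : α) : PosForm (MF.var p)
  | and {φ ψ : MF α} : PosForm φ → PosForm ψ → PosForm (MF.and φ ψ)
  | or {φ ψ : MF α} : PosForm φ → PosForm ψ → PosForm (MF.or φ ψ)
  | dia {φ : MF α} : PosForm φ → PosForm (MF.dia φ)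
  | box {φ : MF α} : PosForm φ → PosForm (MF.box φ)
/-- The modal depth of a formula: maximal nesting of ◇ and □. -/
def MF.depth {α : Type} : MF α → ℕ
  | MF.top => 0
  | MF.bot => 0
  | MF.var _ => 0
  | MF.nvar _ => 0
  | MF.and φ ψ => max φ.depth ψ.depth
  | MF.or φ ψ => max φ.depth ψ.depth
  | MF.dia φ => φ.depth + 1
  | MF.box φ => φ.depth + 1

/-- Syntax trees of basic normal forms: `mk π dias boxd` represents the conjunction
`π ∧ ◇φ₀ ∧ … ∧ ◇φ_k ∧ □(ψ₀ ∨ … ∨ ψ_m)`, where `π` is the (possibly empty)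
conjunction of the variables in the first list, the ◇-conjuncts are given by the
second list, and the □-conjunct is `□` of the non-empty disjunction of the third
list (absent when the third list is empty). -/
inductive BNF (α : Type) : Type
  | mk : List α → List (BNF α) → List (BNF α) → BNF α

mutual
/-- The modal formula represented by a basic normal form tree. -/
def BNF.toMF {α : Type} : BNF α → MF α
  | .mk π dias boxd =>
      match (π.map MF.var) ++ BNF.diasToMF dias ++ BNF.boxToMF boxd with
      | [] => MF.bot
      | h :: t => List.foldl MF.and h t

/-- The list of ◇-conjuncts. -/
def BNF.diasToMF {α : Type} : List (BNF α) → List (MF α)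
  | [] => []
  | b :: bs => MF.dia b.toMF :: BNF.diasToMF bs

/-- The □-conjunct (as a singleton list), i.e. □ of the non-empty disjunction of
the given basic normal forms; absent (the empty list) if there are none. -/
def BNF.boxToMF {α : Type} : List (BNF α) → List (MF α)
  | [] => []
  | b :: bs => [MF.box (List.foldl MF.or b.toMF (BNF.disjToMF bs))]

/-- The formulas of a list of basic normal forms. -/
def BNF.disjToMF {α : Type} : List (BNF α) → List (MF α)
  | [] => []
  | b :: bs => b.toMF :: BNF.disjToMF bs
end

mutual
/-- The level of a basic normal form tree: a conjunction of variables has level 0,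
and otherwise the level is one more than the maximal level of the basic normal
forms occurring under ◇ and □ (so a tree of level `n` is a basic normal form of
level `n'` for every `n' ≥ n`). -/
def BNF.level {α : Type} : BNF α → ℕ
  | .mk _ [] [] => 0
  | .mk _ dias boxd => max (BNF.levelList dias) (BNF.levelList boxd) + 1

def BNF.levelList {α : Type} : List (BNF α) → ℕ
  | [] => 0
  | b :: bs => max b.level (BNF.levelList bs)
end

/-- Well-formedness of a basic normal form tree: the represented conjunction is
non-empty, and recursively for all subtrees. -/
inductive BNF.WF {α : Type} : BNF α → Prop
  | mk (π : List α) (dias boxd : List (BNF α)) :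
      (π ≠ [] ∨ dias ≠ [] ∨ boxd ≠ []) →
      (∀ b ∈ dias, BNF.WF b) → (∀ b ∈ boxd, BNF.WF b) →
      BNF.WF (.mk π dias boxd)

theorem sat_foldl_and {α : Type} (M : PModel α) (w : M.World) (t : List (MF α)) (h : MF α) :
    Sat M w (List.foldl MF.and h t) ↔ ∀ φ ∈ h :: t, Sat M w φ := by
  induction t generalizing h with
  | nil => simp
  | cons a t ih => simp [ih, Sat, and_assoc]

theorem sat_foldl_or {α : Type} (M : PModel α) (w : M.World) (t : List (MF α)) (h : MF α) :
    Sat M w (List.foldl MF.or h t) ↔ ∃ φ ∈ h :: t, Sat M w φ := by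
  induction t generalizing h with
  | nil => simp
  | cons a t ih => simp [ih, Sat, or_assoc]

theorem BNF.diasToMF_eq_map {α : Type} (l : List (BNF α)) :
    BNF.diasToMF l = l.map fun b => MF.dia b.toMF := by
  induction l with
  | nil => rfl
  | cons b l ih => simp [BNF.diasToMF, ih]

theorem BNF.disjToMF_eq_map {α : Type} (l : List (BNF α)) :
    BNF.disjToMF l = l.map BNF.toMF := by
  induction l with
  | nil => rfl
  | cons b l ih => simp [BNF.disjToMF, ih]

theorem BNF.forall_mem_boxToMF {α : Type} (M : PModel α) (w : M.World) (l : List (BNF α)) :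
    (∀ φ ∈ BNF.boxToMF l, Sat M w φ) ↔
      (l ≠ [] → ∀ u, M.Rel w u → ∃ x ∈ l, Sat M u x.toMF) := by
  cases l with
  | nil => simp [BNF.boxToMF]
  | cons b l => simp [BNF.boxToMF, Sat, sat_foldl_or, BNF.disjToMF_eq_map]

theorem BNF.boxToMF_eq_nil {α : Type} (l : List (BNF α)) : BNF.boxToMF l = [] ↔ l = [] := by
  cases l <;> simp [BNF.boxToMF]

theorem BNF.sat_mk {α : Type} (M : PModel α) (w : M.World) (π : List α) (d b : List (BNF α))
    (hne : π ≠ [] ∨ d ≠ [] ∨ b ≠ []) :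
    Sat M w (BNF.mk π d b).toMF ↔ (∀ p ∈ π, p ∈ M.val w) ∧
      (∀ x ∈ d, ∃ u, M.Rel w u ∧ Sat M u x.toMF) ∧
      (b ≠ [] → ∀ u, M.Rel w u → ∃ x ∈ b, Sat M u x.toMF) := by
  have key : Sat M w (BNF.mk π d b).toMF ↔
      ∀ φ ∈ π.map MF.var ++ BNF.diasToMF d ++ BNF.boxToMF b, Sat M w φ := by
    rw [BNF.toMF]
    split
    next heq =>
      simp only [List.append_eq_nil_iff, List.map_eq_nil_iff, BNF.boxToMF_eq_nil,
        BNF.diasToMF_eq_map] at heq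
      tauto
    next h t heq => rw [heq, sat_foldl_and]
  rw [key, ← BNF.forall_mem_boxToMF]
  simp only [List.forall_mem_append, BNF.diasToMF_eq_map, List.forall_mem_map, Sat, and_assoc]

theorem BNF.levelList_le {α : Type} (l : List (BNF α)) (n : ℕ) :
    BNF.levelList l ≤ n ↔ ∀ x ∈ l, x.level ≤ n := by
  induction l with
  | nil => simp [BNF.levelList]
  | cons b l ih => simp [BNF.levelList, ih]

theorem BNF.level_mk_le_zero {α : Type} (π : List α) (d b : List (BNF α)) :
    (BNF.mk π d b).level ≤ 0 ↔ d = [] ∧ b = [] := by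
  cases d <;> cases b <;> simp [BNF.level]

theorem BNF.level_mk_le_succ {α : Type} (π : List α) (d b : List (BNF α)) (n : ℕ) :
    (BNF.mk π d b).level ≤ n + 1 ↔ (∀ x ∈ d, x.level ≤ n) ∧ ∀ x ∈ b, x.level ≤ n := by
  rw [← BNF.levelList_le, ← BNF.levelList_le]
  cases d <;> cases b <;> simp [BNF.level, BNF.levelList, and_assoc]

/-- Well-formed trees of level at most `n`. -/
def BNF.Good {α : Type} (n : ℕ) (b : BNF α) : Prop := b.WF ∧ b.level ≤ n

theorem BNF.Good.mono {α : Type} {m n : ℕ} (h : m ≤ n) {b : BNF α} (hb : b.Good m) : b.Good n :=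
  ⟨hb.1, hb.2.trans h⟩

theorem BNF.wf_mk {α : Type} (π : List α) (d b : List (BNF α)) :
    (BNF.mk π d b).WF ↔
      (π ≠ [] ∨ d ≠ [] ∨ b ≠ []) ∧ (∀ x ∈ d, x.WF) ∧ ∀ x ∈ b, x.WF :=
  ⟨fun | .mk _ _ _ h₁ h₂ h₃ => ⟨h₁, h₂, h₃⟩, fun ⟨h₁, h₂, h₃⟩ => .mk _ _ _ h₁ h₂ h₃⟩

theorem BNF.good_mk_succ {α : Type} (π : List α) (d b : List (BNF α)) (n : ℕ) :
    (BNF.mk π d b).Good (n + 1) ↔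
      (π ≠ [] ∨ d ≠ [] ∨ b ≠ []) ∧ (∀ x ∈ d, x.Good n) ∧ ∀ x ∈ b, x.Good n := by
  simp only [BNF.Good, BNF.wf_mk, BNF.level_mk_le_succ, forall_and]
  tauto

/-- A list of trees of level at most `n` whose disjunction is the property `P` of worlds. -/
def BNF.Represents {α : Type} (n : ℕ) (l : List (BNF α))
    (P : (M : PModel α) → M.World → Prop) : Prop :=
  (∀ x ∈ l, x.Good n) ∧ ∀ M w, P M w ↔ ∃ x ∈ l, Sat M w x.toMF

/-- `f` computes conjunctions of trees of level at most `n`. -/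
def BNF.IsMeet {α : Type} (n : ℕ) (f : BNF α → BNF α → BNF α) : Prop :=
  ∀ a b, a.Good n → b.Good n → (f a b).Good n ∧
    ∀ (M : PModel α) (w : M.World),
      Sat M w (f a b).toMF ↔ Sat M w a.toMF ∧ Sat M w b.toMF

/-- All conjunctions, computed by `f`, of a member of `l` and a member of `l'`. -/
def BNF.meets {α : Type} (f : BNF α → BNF α → BNF α) (l l' : List (BNF α)) : List (BNF α) :=
  l.flatMap fun a => l'.map (f a)

theorem BNF.mem_meets {α : Type} (f : BNF α → BNF α → BNF α) (l l' : List (BNF α)) (x : BNF α) :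
    x ∈ BNF.meets f l l' ↔ ∃ a ∈ l, ∃ b ∈ l', f a b = x := by
  simp [BNF.meets]

theorem BNF.meets_ne_nil {α : Type} (f : BNF α → BNF α → BNF α) {l l' : List (BNF α)}
    (hl : l ≠ []) (hl' : l' ≠ []) : BNF.meets f l l' ≠ [] := by
  obtain ⟨a, ha⟩ := List.exists_mem_of_ne_nil l hl
  obtain ⟨b, hb⟩ := List.exists_mem_of_ne_nil l' hl'
  exact List.ne_nil_of_mem ((BNF.mem_meets f l l' _).2 ⟨a, ha, b, hb, rfl⟩)

theorem BNF.IsMeet.represents {α : Type} {n : ℕ} {f : BNF α → BNF α → BNF α}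
    (hf : BNF.IsMeet n f) {l l' : List (BNF α)} {P Q : (M : PModel α) → M.World → Prop}
    (hl : BNF.Represents n l P) (hl' : BNF.Represents n l' Q) :
    BNF.Represents n (BNF.meets f l l') fun M w => P M w ∧ Q M w := by
  refine ⟨fun x hx => ?_, fun M w => ?_⟩
  · obtain ⟨a, ha, b, hb, rfl⟩ := (BNF.mem_meets f l l' x).1 hx
    exact (hf a b (hl.1 a ha) (hl'.1 b hb)).1
  · simp only [hl.2, hl'.2]
    constructor
    · rintro ⟨⟨a, ha, hsa⟩, b, hb, hsb⟩
      exact ⟨f a b, (BNF.mem_meets f l l' _).2 ⟨a, ha, b, hb, rfl⟩,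
        ((hf a b (hl.1 a ha) (hl'.1 b hb)).2 M w).2 ⟨hsa, hsb⟩⟩
    · rintro ⟨x, hx, hsx⟩
      obtain ⟨a, ha, b, hb, rfl⟩ := (BNF.mem_meets f l l' x).1 hx
      have h := ((hf a b (hl.1 a ha) (hl'.1 b hb)).2 M w).1 hsx
      exact ⟨⟨a, ha, h.1⟩, b, hb, h.2⟩

/-- Boxes of two non-empty disjunctions merge, an empty list standing for an absent box. -/
theorem BNF.IsMeet.exists_box {α : Type} {n : ℕ} {f : BNF α → BNF α → BNF α}
    (hf : BNF.IsMeet n f) (l l' : List (BNF α)) (hl : ∀ x ∈ l, x.Good n)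
    (hl' : ∀ x ∈ l', x.Good n) :
    ∃ m : List (BNF α), (∀ x ∈ m, x.Good n) ∧ (m = [] ↔ l = [] ∧ l' = []) ∧
      ∀ (M : PModel α) (w : M.World),
        (m ≠ [] → ∀ u, M.Rel w u → ∃ x ∈ m, Sat M u x.toMF) ↔
          (l ≠ [] → ∀ u, M.Rel w u → ∃ x ∈ l, Sat M u x.toMF) ∧
          (l' ≠ [] → ∀ u, M.Rel w u → ∃ x ∈ l', Sat M u x.toMF) := by
  by_cases h : l = []
  · exact ⟨l', hl', by simp [h], by simp [h]⟩
  by_cases h' : l' = []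
  · exact ⟨l, hl, by simp [h'], by simp [h']⟩
  have hr := hf.represents (l := l) (l' := l') ⟨hl, fun _ _ => Iff.rfl⟩ ⟨hl', fun _ _ => Iff.rfl⟩
  have hm := BNF.meets_ne_nil f h h'
  refine ⟨BNF.meets f l l', hr.1, by simp [hm, h], fun M w => ?_⟩
  simp only [← hr.2, hm, h, h', ne_eq, not_false_eq_true, forall_const, forall_and]

theorem BNF.exists_isMeet (α : Type) (n : ℕ) :
    ∃ f : BNF α → BNF α → BNF α, BNF.IsMeet n f := by
  suffices h : ∀ a b : BNF α, ∃ c : BNF α, a.Good n → b.Good n → c.Good n ∧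
      ∀ (M : PModel α) (w : M.World),
        Sat M w c.toMF ↔ Sat M w a.toMF ∧ Sat M w b.toMF by
    choose f hf using h
    exact ⟨f, hf⟩
  induction n with
  | zero =>
    rintro ⟨π, d, b⟩ ⟨π', d', b'⟩
    refine ⟨.mk (π ++ π') [] [], fun ⟨hw, hl⟩ ⟨hw', hl'⟩ => ?_⟩
    obtain ⟨rfl, rfl⟩ := (BNF.level_mk_le_zero _ _ _).1 hl
    obtain ⟨rfl, rfl⟩ := (BNF.level_mk_le_zero _ _ _).1 hl'
    have hπ := ((BNF.wf_mk _ _ _).1 hw).1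
    have hπ' := ((BNF.wf_mk _ _ _).1 hw').1
    have hne : π ++ π' ≠ [] ∨ ([] : List (BNF α)) ≠ [] ∨ ([] : List (BNF α)) ≠ [] := by
      simp_all
    refine ⟨⟨(BNF.wf_mk _ _ _).2 ⟨hne, by simp, by simp⟩,
      (BNF.level_mk_le_zero _ _ _).2 ⟨rfl, rfl⟩⟩, fun M w => ?_⟩
    rw [BNF.sat_mk M w _ _ _ hπ, BNF.sat_mk M w _ _ _ hπ', BNF.sat_mk M w _ _ _ hne,
      List.forall_mem_append]
    simp
  | succ n ih =>
    choose f hf using ih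
    have hf : BNF.IsMeet n f := hf
    rintro ⟨π, d, b⟩ ⟨π', d', b'⟩
    by_cases hg : (BNF.mk π d b).Good (n + 1) ∧ (BNF.mk π' d' b').Good (n + 1)
    swap
    · exact ⟨.mk π d b, fun h h' => absurd ⟨h, h'⟩ hg⟩
    simp only [BNF.good_mk_succ] at hg
    obtain ⟨⟨hne, hd, hb⟩, hne', hd', hb'⟩ := hg
    obtain ⟨m, hm, hmnil, hms⟩ := hf.exists_box b b' hb hb'
    have hneq : π ++ π' ≠ [] ∨ d ++ d' ≠ [] ∨ m ≠ [] := by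
      simp only [ne_eq, hmnil, List.append_eq_nil_iff]
      tauto
    refine ⟨.mk (π ++ π') (d ++ d') m, fun _ _ => ⟨(BNF.good_mk_succ _ _ _ _).2
      ⟨hneq, List.forall_mem_append.2 ⟨hd, hd'⟩, hm⟩, fun M w => ?_⟩⟩
    rw [BNF.sat_mk M w _ _ _ hne, BNF.sat_mk M w _ _ _ hne', BNF.sat_mk M w _ _ _ hneq,
      List.forall_mem_append, List.forall_mem_append, hms]
    tauto

theorem PosForm.exists_represents {α : Type} {φ : MF α} (hφ : PosForm φ) :
    ∃ l : List (BNF α), l ≠ [] ∧ BNF.Represents φ.depth l fun M w => Sat M w φ := by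
  induction hφ with
  | var p =>
    refine ⟨[.mk [p] [] []], by simp, ?_, fun M w => ?_⟩
    · simp [BNF.Good, BNF.wf_mk, BNF.level]
    · simp [BNF.sat_mk, Sat]
  | @and φ ψ _ _ ih₁ ih₂ =>
    obtain ⟨l, hl, hg, hs⟩ := ih₁
    obtain ⟨l', hl', hg', hs'⟩ := ih₂
    obtain ⟨f, hf⟩ := BNF.exists_isMeet α (max φ.depth ψ.depth)
    exact ⟨BNF.meets f l l', BNF.meets_ne_nil f hl hl', hf.represents
      ⟨fun x hx => (hg x hx).mono (le_max_left _ _), hs⟩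
      ⟨fun x hx => (hg' x hx).mono (le_max_right _ _), hs'⟩⟩
  | @or φ ψ _ _ ih₁ ih₂ =>
    obtain ⟨l, hl, hg, hs⟩ := ih₁
    obtain ⟨l', hl', hg', hs'⟩ := ih₂
    refine ⟨l ++ l', by simp [hl], List.forall_mem_append.2
      ⟨fun x hx => (hg x hx).mono (le_max_left _ _),
        fun x hx => (hg' x hx).mono (le_max_right _ _)⟩, fun M w => ?_⟩
    simp only [Sat, hs, hs', List.mem_append, or_and_right, exists_or]
  | @dia φ _ ih =>
    obtain ⟨l, hl, hg, hs⟩ := ih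
    refine ⟨l.map fun x => .mk [] [x] [], by simpa using hl, ?_, fun M w => ?_⟩
    · simpa [MF.depth, BNF.good_mk_succ] using hg
    · simp only [Sat, hs, List.mem_map, exists_exists_and_eq_and]
      simp only [BNF.sat_mk, ne_eq, List.cons_ne_nil, not_false_eq_true, true_or, or_true,
        List.mem_singleton, forall_eq, List.not_mem_nil, false_imp_iff, implies_true, true_and,
        not_true_eq_false, and_true]
      exact ⟨fun ⟨u, hu, x, hx, h⟩ => ⟨x, hx, u, hu, h⟩, fun ⟨x, hx, u, hu, h⟩ => ⟨u, hu, x, hx, h⟩⟩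
  | @box φ _ ih =>
    obtain ⟨l, hl, hg, hs⟩ := ih
    refine ⟨[.mk [] [] l], by simp, ?_, fun M w => ?_⟩
    · simpa [MF.depth, BNF.good_mk_succ, hl] using hg
    · simp [Sat, hs, BNF.sat_mk, hl]

/-- every formula `φ ∈ L_{□,◇,∧,∨}[Prop]` is equivalent to a normal
form of level `d(φ)`, i.e. a non-empty disjunction of (well-formed) basic normal
forms of level at most `d(φ)`. -/
theorem posForm_normalForm {α : Type} [Fintype α] (φ : MF α) (hφ : PosForm φ) :
    ∃ (b : BNF α) (bs : List (BNF α)),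
      BNF.WF b ∧ (∀ x ∈ bs, BNF.WF x) ∧
      BNF.level b ≤ φ.depth ∧ (∀ x ∈ bs, BNF.level x ≤ φ.depth) ∧
      MFEquiv φ (List.foldl MF.or b.toMF (bs.map BNF.toMF)) := by
  obtain ⟨l, hl, hg, hs⟩ := hφ.exists_represents
  obtain ⟨b, bs, rfl⟩ := List.exists_cons_of_ne_nil hl
  rw [List.forall_mem_cons] at hg
  refine ⟨b, bs, hg.1.1, fun x hx => (hg.2 x hx).1, hg.1.2, fun x hx => (hg.2 x hx).2,
    fun M => ?_⟩
  rw [PSat, PSat, sat_foldl_or]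
  simpa using hs M M.pt
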